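/- Let n ∈ ℕ and E = EuclideanSpace ℝ (Fin n). Let φ : ℝ × E → ℝ, u : ℝ × E → E and r : ℝ → ℝ, and write ρ = r∘φ for the density. Fix (t₀, x₀) and assume: φ is differentiable at (t₀, x₀); r is differentiable at φ(t₀, x₀); the map x ↦ u(t₀, x) is differentiable at x₀; and the conservative order-parameter equation with vanishing flux holds at the point, ∂_t φ(t₀,x₀) + div_x (φ·u)(t₀,x₀) = 0. Then ∂_t ρ(t₀,x₀) + div_x (ρ·u)(t₀,x₀) = (ρ(t₀,x₀) − φ(t₀,x₀)·r'(φ(t₀,x₀))) · div_x u(t₀,x₀). (Hence, if additionally ρ − φ·r'(φ) ≠ 0 at the point, the continuity equation holds there if and only if div_x u vanishes there.) -/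

import Mathlib

open scoped RealInnerProductSpace

/-- Divergence of a spatial vector field at a point. -/
noncomputable def spaceDiv {n : ℕ}
    (v : EuclideanSpace ℝ (Fin n) → EuclideanSpace ℝ (Fin n))
    (x : EuclideanSpace ℝ (Fin n)) : ℝ :=
  ∑ i : Fin n, fderiv ℝ (fun y => v y i) x (EuclideanSpace.single i 1)

/-- The divergence product rule: `div (f v) = df(v) + f div v`. -/
theorem spaceDiv_smul {n : ℕ} {f : EuclideanSpace ℝ (Fin n) → ℝ}
    {v : EuclideanSpace ℝ (Fin n) → EuclideanSpace ℝ (Fin n)}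
    {x : EuclideanSpace ℝ (Fin n)}
    (hf : DifferentiableAt ℝ f x) (hv : DifferentiableAt ℝ v x) :
    spaceDiv (fun y => f y • v y) x = fderiv ℝ f x (v x) + f x * spaceDiv v x := by
  have hvi (i : Fin n) : DifferentiableAt ℝ (fun y => v y i) x :=
    (differentiableAt_euclidean.mp hv) i
  have hdecomp : fderiv ℝ f x (v x)
      = ∑ i, v x i * fderiv ℝ f x (EuclideanSpace.single i 1) := by
    conv_lhs => rw [← (EuclideanSpace.basisFun (Fin n) ℝ).sum_repr (v x)]
    simp [map_sum]
  have hterm (i : Fin n) :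
      fderiv ℝ (fun y => (f y • v y) i) x (EuclideanSpace.single i 1)
        = v x i * fderiv ℝ f x (EuclideanSpace.single i 1)
          + f x * fderiv ℝ (fun y => v y i) x (EuclideanSpace.single i 1) := by
    have h := (hf.hasFDerivAt.mul (hvi i).hasFDerivAt).fderiv
    change fderiv ℝ (f * fun y => v y i) x _ = _
    rw [h]
    simp [add_comm]
  simp only [spaceDiv, hterm, Finset.sum_add_distrib, Finset.mul_sum, hdecomp]

/-- Under the conservative order-parameter equation with vanishing flux,
the continuity defect of the density `ρ = r ∘ φ` equals `(ρ − φ·r'(φ)) · div u`. -/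
theorem continuity_defect_conservative
    {n : ℕ}
    (φ : ℝ × EuclideanSpace ℝ (Fin n) → ℝ)
    (u : ℝ × EuclideanSpace ℝ (Fin n) → EuclideanSpace ℝ (Fin n))
    (r : ℝ → ℝ)
    (t₀ : ℝ) (x₀ : EuclideanSpace ℝ (Fin n))
    (hφ : DifferentiableAt ℝ φ (t₀, x₀))
    (hr : DifferentiableAt ℝ r (φ (t₀, x₀)))
    (hu : DifferentiableAt ℝ (fun x => u (t₀, x)) x₀)
    (hevol : deriv (fun t => φ (t, x₀)) t₀
        + spaceDiv (fun x => φ (t₀, x) • u (t₀, x)) x₀ = 0) :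
    deriv (fun t => r (φ (t, x₀))) t₀
        + spaceDiv (fun x => r (φ (t₀, x)) • u (t₀, x)) x₀
      = (r (φ (t₀, x₀)) - φ (t₀, x₀) * deriv r (φ (t₀, x₀)))
          * spaceDiv (fun x => u (t₀, x)) x₀ := by
  have hφt : DifferentiableAt ℝ (fun t => φ (t, x₀)) t₀ :=
    DifferentiableAt.comp t₀ (f := fun t => (t, x₀)) hφ (by fun_prop)
  have hφx : DifferentiableAt ℝ (fun x => φ (t₀, x)) x₀ :=
    DifferentiableAt.comp x₀ (f := fun x => (t₀, x)) hφ (by fun_prop)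
  have hrt : deriv (fun t => r (φ (t, x₀))) t₀
      = deriv r (φ (t₀, x₀)) * deriv (fun t => φ (t, x₀)) t₀ :=
    (HasDerivAt.comp t₀ (h := fun t => φ (t, x₀)) hr.hasDerivAt hφt.hasDerivAt).deriv
  have hrx : HasFDerivAt (fun x => r (φ (t₀, x)))
      (deriv r (φ (t₀, x₀)) • fderiv ℝ (fun x => φ (t₀, x)) x₀) x₀ :=
    HasDerivAt.comp_hasFDerivAt x₀ (f := fun x => φ (t₀, x)) hr.hasDerivAt hφx.hasFDerivAt
  rw [spaceDiv_smul hφx hu] at hevol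
  rw [spaceDiv_smul hrx.differentiableAt hu, hrt, hrx.fderiv, smul_apply,
    smul_eq_mul]
  linear_combination deriv r (φ (t₀, x₀)) * hevol
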